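/- Let C be a 2×2 real matrix, β ∈ ℝ², and t ∈ ℝ with t > 1. Assume C + 1 and C + t•1 are invertible (where 1 is the identity matrix). Define C' = (t•C + 1)·(C + t•1)⁻¹, β' = √(t² − 1)·((C + t•1)⁻¹.mulVec β), and t̃ = (t − 1)/(t + 1). Then C' + 1 is invertible, (C' + 1)⁻¹·(C' − 1) = t̃·((C + 1)⁻¹·(C − 1)), and (C' + 1)⁻¹.mulVec β' = √t̃·((C + 1)⁻¹.mulVec β). -/

import Mathlib

theorem stmt_4 (C : Matrix (Fin 2) (Fin 2) ℝ) (β : Fin 2 → ℝ) (t : ℝ) (ht : 1 < t)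
    (h1 : IsUnit (C + 1)) (h2 : IsUnit (C + t • (1 : Matrix (Fin 2) (Fin 2) ℝ)))
    (C' : Matrix (Fin 2) (Fin 2) ℝ) (β' : Fin 2 → ℝ) (ttil : ℝ)
    (hC' : C' = (t • C + 1) * (C + t • (1 : Matrix (Fin 2) (Fin 2) ℝ))⁻¹)
    (hβ' : β' = Real.sqrt (t ^ 2 - 1) •
      ((C + t • (1 : Matrix (Fin 2) (Fin 2) ℝ))⁻¹.mulVec β))
    (httil : ttil = (t - 1) / (t + 1)) :
    IsUnit (C' + 1) ∧
      (C' + 1)⁻¹ * (C' - 1) = ttil • ((C + 1)⁻¹ * (C - 1)) ∧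
      (C' + 1)⁻¹.mulVec β' = Real.sqrt ttil • ((C + 1)⁻¹.mulVec β) := by
  have ht1 : t + 1 ≠ 0 := by linarith
  have d1 := (Matrix.isUnit_iff_isUnit_det _).1 h1
  have d2 := (Matrix.isUnit_iff_isUnit_det _).1 h2
  have hAF := Matrix.mul_nonsing_inv _ d1
  have hFA := Matrix.nonsing_inv_mul _ d1
  have hDE := Matrix.mul_nonsing_inv _ d2
  have hED := Matrix.nonsing_inv_mul _ d2
  obtain ⟨D, hD⟩ : ∃ D, D = C + t • (1 : Matrix (Fin 2) (Fin 2) ℝ) := ⟨_, rfl⟩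
  rw [← hD] at hDE hED hC' hβ'
  generalize D⁻¹ = E at *
  generalize (C + 1)⁻¹ = F at *
  have hDA : D = (C + 1) + (t - 1) • (1 : Matrix (Fin 2) (Fin 2) ℝ) := by
    rw [hD, sub_smul, one_smul]; abel
  have hFD : D * F = F * D := by
    rw [hDA, add_mul, mul_add, hAF, hFA, smul_mul_assoc, mul_smul_comm, one_mul, mul_one]
  have hp : C' + 1 = (t + 1) • ((C + 1) * E) := by
    have : (1 : Matrix (Fin 2) (Fin 2) ℝ) = D * E := hDE.symm
    calc C' + 1 = (t • C + 1) * E + D * E := by rw [hC', hDE]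
      _ = ((t + 1) • (C + 1)) * E := by
        rw [← add_mul, hD]; congr 1; module
      _ = _ := smul_mul_assoc _ _ _
  have hm : C' - 1 = (t - 1) • ((C - 1) * E) := by
    calc C' - 1 = (t • C + 1) * E - D * E := by rw [hC', hDE]
      _ = ((t - 1) • (C - 1)) * E := by
        rw [← sub_mul, hD]; congr 1; module
      _ = _ := smul_mul_assoc _ _ _
  have hi : (C' + 1) * ((t + 1)⁻¹ • (D * F)) = 1 := by
    rw [hp, smul_mul_assoc, mul_smul_comm, smul_smul, mul_inv_cancel₀ ht1, one_smul,
      mul_assoc, ← mul_assoc E, hED, one_mul, hAF]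
  have hinv : (C' + 1)⁻¹ = (t + 1)⁻¹ • (D * F) := Matrix.inv_eq_right_inv hi
  have hcomm : D * (C - 1) = (C - 1) * D := by
    rw [hD]; simp only [add_mul, mul_add, sub_mul, mul_sub, smul_mul_assoc, mul_smul_comm,
      one_mul, mul_one]
    module
  refine ⟨(Matrix.isUnit_iff_isUnit_det _).2 (Matrix.isUnit_det_of_right_inverse hi), ?_, ?_⟩
  · rw [hinv, hm, smul_mul_assoc, mul_smul_comm, smul_smul, hFD, httil]
    have : F * D * ((C - 1) * E) = F * (C - 1) := by
      rw [mul_assoc, ← mul_assoc D, hcomm, mul_assoc (C - 1), hDE, mul_one]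
    rw [this, div_eq_inv_mul]
  · have hs : (t + 1)⁻¹ * Real.sqrt (t ^ 2 - 1) = Real.sqrt ttil := by
      have : t ^ 2 - 1 = (t + 1) ^ 2 * ttil := by rw [httil]; field_simp; ring
      rw [this, Real.sqrt_mul (sq_nonneg _), Real.sqrt_sq (by linarith), ← mul_assoc,
        inv_mul_cancel₀ ht1, one_mul]
    rw [hinv, hβ', Matrix.smul_mulVec, Matrix.mulVec_smul, smul_smul, hs, Matrix.mulVec_mulVec,
      hFD, mul_assoc, hDE, mul_one]
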